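/- Assume J_ρ ≠ 𝒥, let J ⊆ 𝒥 and let j ∉ J_ρ. For J′ ⊆ 𝒥 put S_1(J′) = #{i ≥ 0 : j ∈ δ_ss^i(J′) and j+1 ∉ δ_ss^i(J′)} and S_2(J′) = #{i ≥ 0 : j ∉ δ_ss^i(J′) and j+1 ∈ δ_ss^i(J′)} (these sets are finite). Then (S_2(J) − S_2(J^{ss})) − (S_1(J) − S_1(J^{ss})) = 1_{j+k(j)+1 ∈ J} − 1_{j ∈ J}. -/

import Mathlib

open Finset
open scoped symmDiff

def shiftSet (f : ℕ) (J : Finset (ZMod f)) (k : ℤ) : Finset (ZMod f) :=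
  J.image (fun j => j + (k : ZMod f))

def deltaSS (f : ℕ) (Jrho J : Finset (ZMod f)) : Finset (ZMod f) :=
  shiftSet f J (-1) ∩ Jrho

def sfun (p f : ℕ) (r : ZMod f → ℤ) (Jrho J : Finset (ZMod f)) (j : ZMod f) : ℤ :=
  if j ∈ J then
    if j + 1 ∈ J then (if j ∈ Jrho then (p : ℤ) - 3 - r j else (p : ℤ) - 1 - r j)
    else r j + 1
  else
    if j + 1 ∈ J then (p : ℤ) - 2 - r j else r j

def tfun (f : ℕ) (r : ZMod f → ℤ) (Jrho J : Finset (ZMod f)) (j : ZMod f) : ℤ :=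
  if j ∈ J then
    if j + 1 ∈ J then (if j ∈ Jrho then r j + 1 else r j)
    else -1
  else
    if j + 1 ∈ J then r j + 1 else 0


def Sone (f : ℕ) (Jrho : Finset (ZMod f)) (j : ZMod f) (J' : Finset (ZMod f)) : Set ℕ :=
  {i : ℕ | j ∈ (deltaSS f Jrho)^[i] J' ∧ j + 1 ∉ (deltaSS f Jrho)^[i] J'}

def Stwo (f : ℕ) (Jrho : Finset (ZMod f)) (j : ZMod f) (J' : Finset (ZMod f)) : Set ℕ :=
  {i : ℕ | j ∉ (deltaSS f Jrho)^[i] J' ∧ j + 1 ∈ (deltaSS f Jrho)^[i] J'}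


theorem mem_deltaSS {f : ℕ} {Jrho J : Finset (ZMod f)} {x : ZMod f} :
    x ∈ deltaSS f Jrho J ↔ x + 1 ∈ J ∧ x ∈ Jrho := by
  simp only [deltaSS, shiftSet, Finset.mem_inter, Finset.mem_image]
  refine and_congr_left fun _ => ⟨?_, fun h => ⟨x + 1, h, by push_cast; ring⟩⟩
  rintro ⟨y, hy, rfl⟩
  simpa using hy

theorem mem_deltaSS_iterate {f : ℕ} {Jrho J : Finset (ZMod f)} (i : ℕ) {x : ZMod f} :
    x ∈ (deltaSS f Jrho)^[i] J ↔
      x + (i : ZMod f) ∈ J ∧ ∀ m : ℕ, m < i → x + (m : ZMod f) ∈ Jrho := by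
  induction i generalizing x with
  | zero => simp
  | succ n ih =>
    rw [Function.iterate_succ_apply', mem_deltaSS, ih, Nat.forall_lt_succ_left, and_assoc]
    have shift (m : ℕ) : x + 1 + (m : ZMod f) = x + ((m + 1 : ℕ) : ZMod f) := by push_cast; ring
    simp only [shift, Nat.cast_zero, add_zero]
    tauto

theorem mem_deltaSS_iterate_of_notMem {f : ℕ} {Jrho J : Finset (ZMod f)} {j : ZMod f}
    (hj : j ∉ Jrho) (i : ℕ) : j ∈ (deltaSS f Jrho)^[i] J ↔ i = 0 ∧ j ∈ J := by
  rw [mem_deltaSS_iterate]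
  rcases i with _ | n
  · simp
  · simp only [Nat.add_eq_zero_iff, one_ne_zero, and_false, false_and, iff_false, not_and]
    intro _ h
    exact hj (by simpa using h 0 n.succ_pos)

theorem add_one_mem_deltaSS_iterate {f : ℕ} {Jrho J : Finset (ZMod f)} {j : ZMod f} {k : ℕ}
    (hk1 : ∀ i : ℕ, 1 ≤ i → i ≤ k → j + (i : ZMod f) ∈ Jrho)
    (hk2 : j + (k : ZMod f) + 1 ∉ Jrho) (i : ℕ) :
    j + 1 ∈ (deltaSS f Jrho)^[i] J ↔ i ≤ k ∧ j + (i : ZMod f) + 1 ∈ J := by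
  rw [mem_deltaSS_iterate, add_right_comm, and_comm]
  refine and_congr_left fun _ => ⟨fun h => ?_, fun hik m hm => ?_⟩
  · by_contra! hki
    exact hk2 (by simpa only [add_right_comm] using h k hki)
  · have := hk1 (m + 1) (by omega) (by omega)
    rwa [Nat.cast_succ, ← add_assoc, add_right_comm] at this

theorem ncard_eq_sum_range {S : Set ℕ} [DecidablePred (· ∈ S)] {n : ℕ}
    (hS : ∀ i ∈ S, i < n) :
    (S.ncard : ℤ) = ∑ i ∈ Finset.range n, if i ∈ S then 1 else 0 := by
  have h : S = ((Finset.range n).filter (· ∈ S) : Finset ℕ) := by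
    ext i
    simpa using hS i
  rw [Finset.sum_boole, ← Set.ncard_coe_finset, ← h]

theorem Sone_lt_and_Stwo_lt {f : ℕ} {Jrho : Finset (ZMod f)} {j : ZMod f} (hj : j ∉ Jrho) {k : ℕ}
    (hk1 : ∀ i : ℕ, 1 ≤ i → i ≤ k → j + (i : ZMod f) ∈ Jrho)
    (hk2 : j + (k : ZMod f) + 1 ∉ Jrho) (J : Finset (ZMod f)) :
    (∀ i ∈ Sone f Jrho j J, i < k + 1) ∧ ∀ i ∈ Stwo f Jrho j J, i < k + 1 := by
  simp only [Sone, Stwo, Set.mem_ofPred_eq, mem_deltaSS_iterate_of_notMem hj,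
    add_one_mem_deltaSS_iterate hk1 hk2]
  constructor <;> intro i hi <;> omega

theorem ncard_Stwo_sub_ncard_Sone {f : ℕ} {Jrho : Finset (ZMod f)} {j : ZMod f} (hj : j ∉ Jrho)
    {k : ℕ} (hk1 : ∀ i : ℕ, 1 ≤ i → i ≤ k → j + (i : ZMod f) ∈ Jrho)
    (hk2 : j + (k : ZMod f) + 1 ∉ Jrho) (J : Finset (ZMod f)) :
    ((Stwo f Jrho j J).ncard : ℤ) - ((Sone f Jrho j J).ncard : ℤ) =
      (∑ i ∈ Finset.range (k + 1), if j + (i : ZMod f) + 1 ∈ J then 1 else 0)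
        - if j ∈ J then 1 else 0 := by
  classical
  obtain ⟨h1, h2⟩ := Sone_lt_and_Stwo_lt hj hk1 hk2 J
  have h0 : (if j ∈ J then 1 else 0 : ℤ) =
      ∑ i ∈ Finset.range (k + 1), if i = 0 then (if j ∈ J then 1 else 0) else 0 := by
    simp
  rw [ncard_eq_sum_range h1, ncard_eq_sum_range h2, h0, ← Finset.sum_sub_distrib,
    ← Finset.sum_sub_distrib]
  refine Finset.sum_congr rfl fun i hi => ?_
  have hik : i ≤ k := Nat.lt_succ_iff.mp (Finset.mem_range.mp hi)
  simp only [Sone, Stwo, Set.mem_ofPred_eq, mem_deltaSS_iterate_of_notMem hj,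
    add_one_mem_deltaSS_iterate hk1 hk2, hik, true_and]
  by_cases hi0 : i = 0 <;> by_cases hjJ : j ∈ J <;> by_cases hiJ : j + (i : ZMod f) + 1 ∈ J <;>
    simp [hi0, hjJ, hiJ] <;> simp_all

/-- the case `j ∉ J_ρ`. -/
theorem statement11 (f : ℕ) [NeZero f] (hf : 1 ≤ f) (Jrho : Finset (ZMod f))
    (hJrho : Jrho ≠ Finset.univ)
    (J : Finset (ZMod f)) (j : ZMod f) (hj : j ∉ Jrho)
    (k : ℕ) (hkf : k < f)
    (hk1 : ∀ i : ℕ, 1 ≤ i → i ≤ k → j + (i : ZMod f) ∈ Jrho)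
    (hk2 : j + (k : ZMod f) + 1 ∉ Jrho) :
    (Sone f Jrho j J).Finite ∧ (Stwo f Jrho j J).Finite ∧
    (Sone f Jrho j (J ∩ Jrho)).Finite ∧ (Stwo f Jrho j (J ∩ Jrho)).Finite ∧
    (((Stwo f Jrho j J).ncard : ℤ) - ((Stwo f Jrho j (J ∩ Jrho)).ncard : ℤ))
      - (((Sone f Jrho j J).ncard : ℤ) - ((Sone f Jrho j (J ∩ Jrho)).ncard : ℤ))
      = (if j + (k : ZMod f) + 1 ∈ J then 1 else 0) - (if j ∈ J then 1 else 0) := by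
  have fin (J' : Finset (ZMod f)) :
      (Sone f Jrho j J').Finite ∧ (Stwo f Jrho j J').Finite := by
    obtain ⟨h1, h2⟩ := Sone_lt_and_Stwo_lt hj hk1 hk2 J'
    exact ⟨(Set.finite_lt_nat (k + 1)).subset h1, (Set.finite_lt_nat (k + 1)).subset h2⟩
  refine ⟨(fin _).1, (fin _).2, (fin _).1, (fin _).2, ?_⟩
  have hJ := ncard_Stwo_sub_ncard_Sone hj hk1 hk2 J
  have hss := ncard_Stwo_sub_ncard_Sone hj hk1 hk2 (J ∩ Jrho)
  have hsum : (∑ i ∈ Finset.range k, if j + (i : ZMod f) + 1 ∈ J ∩ Jrho then 1 else 0 : ℤ) =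
      ∑ i ∈ Finset.range k, if j + (i : ZMod f) + 1 ∈ J then 1 else 0 := by
    refine Finset.sum_congr rfl fun i hi => ?_
    have hmem := hk1 (i + 1) (by omega) (Finset.mem_range.mp hi)
    rw [Nat.cast_succ, ← add_assoc] at hmem
    simp [hmem]
  rw [Finset.sum_range_succ] at hJ hss
  rw [hsum, if_neg (by simp [hk2]), if_neg (by simp [hj])] at hss
  linarith
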